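/- arXiv:2505.20735 — 3 statements merged into one kernel-verified Lean document; each statement's English description precedes it below -/
import Mathlib

section
/- Let (A, ∘) be a finite-dimensional Novikov algebra, r ∈ A⊗A, and write r̂ = α + β where α := (r̂ − r̂ᵗ)/2 and β := (r̂ + r̂ᵗ)/2. Assume the symmetric part (r + τr)/2 of r is invariant. Then the following are equivalent: (1) r is a solution of the Novikov Yang–Baxter equation r₁₃∘r₂₃ + r₁₂⋆r₂₃ + r₁₃∘r₁₂ = 0; (2) r̂(a*)∘r̂(b*) = r̂(L_{A,⋆}*(r̂(a*))b* − R_A*(r̂(b*))a* − 2L_{A,⋆}*(β(a*))b*) for all a*, b* ∈ A*, and likewise (−r̂ᵗ)(a*)∘(−r̂ᵗ)(b*) = (−r̂ᵗ)(L_{A,⋆}*((−r̂ᵗ)(a*))b* − R_A*((−r̂ᵗ)(b*))a* + 2L_{A,⋆}*(β(a*))b*) for all a*, b* ∈ A*; (3) α(a*)∘α(b*) − α(L_{A,⋆}*(α(a*))b* − R_A*(α(b*))a*) = −β(a*)∘β(b*) for all a*, b* ∈ A*; (4) (α ± β)(a* ∗ b*) = (α ± β)(a*)∘(α ± β)(b*)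 for all a*, b* ∈ A* and both signs, where a* ∗ b* := L_{A,⋆}*(r̂(a*))b* + R_A*(r̂ᵗ(b*))a*. -/
open TensorProduct


section Defs

variable {k : Type*} [Field k] [CharZero k]
variable {A : Type*} [AddCommGroup A] [Module k A]
variable {M : Type*} [AddCommGroup M] [Module k M]

/-- A bilinear operation satisfying the Novikov algebra axioms. -/
def IsNovikov (mul : A →ₗ[k] A →ₗ[k] A) : Prop :=
  (∀ a b c : A, mul (mul a b) c - mul a (mul b c) = mul (mul b a) c - mul b (mul a c)) ∧
  (∀ a b c : A, mul (mul a b) c = mul (mul a c) b)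

/-- `(M, l, r)` is a bimodule of the Novikov algebra `(A, mul)`. -/
def IsNovikovBimodule (mul : A →ₗ[k] A →ₗ[k] A)
    (l r : A →ₗ[k] Module.End k M) : Prop :=
  (∀ (a b : A) (v : M), l (mul a b - mul b a) v = l a (l b v) - l b (l a v)) ∧
  (∀ (a b : A) (v : M), l a (r b v) - r b (l a v) = r (mul a b) v - r b (r a v)) ∧
  (∀ (a b : A) (v : M), l (mul a b) v = r b (l a v)) ∧
  (∀ (a b : A) (v : M), r a (r b v) = r b (r a v))

/-- `(M, mulM, l, r)` is an `A`-bimodule Novikov algebra over the Novikov algebra `(A, mulA)`. -/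
def IsBimoduleNovikovAlgebra (mulA : A →ₗ[k] A →ₗ[k] A)
    (mulM : M →ₗ[k] M →ₗ[k] M) (l r : A →ₗ[k] Module.End k M) : Prop :=
  IsNovikov mulM ∧ IsNovikovBimodule mulA l r ∧
  (∀ (a : A) (v w : M), mulM (l a v) w - l a (mulM v w) = mulM (r a v) w - mulM v (l a w)) ∧
  (∀ (a : A) (v w : M), r a (mulM v w) - mulM v (r a w) = r a (mulM w v) - mulM w (r a v)) ∧
  (∀ (a : A) (v w : M), mulM (l a v) w = mulM (l a w) v) ∧
  (∀ (a : A) (v w : M), r a (mulM v w) = mulM (r a v) w)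

/-- O-operator of weight `lam` on `(A, mulA)` associated to the A-bimodule Novikov algebra
`(M, mulM, l, r)`. -/
def IsOOperator (mulA : A →ₗ[k] A →ₗ[k] A) (mulM : M →ₗ[k] M →ₗ[k] M)
    (l r : A →ₗ[k] Module.End k M) (lam : k) (α : M →ₗ[k] A) : Prop :=
  ∀ u v : M, mulA (α u) (α v) = α (l (α u) v + r (α v) u + lam • mulM u v)

/-- Post-Novikov algebra axioms: `circ` is Novikov and the eight compatibility conditions hold,
where `lhd a b = a ◁ b` and `rhd a b = a ▷ b`. -/
def IsPostNovikov (circ lhd rhd : A →ₗ[k] A →ₗ[k] A) : Prop :=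
  IsNovikov circ ∧
  (∀ a b c : A, lhd (rhd a c) b = rhd (rhd a b + lhd a b + circ a b) c) ∧
  (∀ a b c : A, rhd a (lhd c b) - lhd (rhd a c) b + lhd (lhd c a) b
      = lhd c (lhd a b + rhd a b + circ a b)) ∧
  (∀ a b c : A, rhd (rhd a b + lhd a b + circ a b) c - rhd (rhd b a + lhd b a + circ b a) c
      = rhd a (rhd b c) - rhd b (rhd a c)) ∧
  (∀ a b c : A, lhd (lhd a b) c = lhd (lhd a c) b) ∧
  (∀ a b c : A, circ (rhd a b) c - rhd a (circ b c) = circ (lhd b a) c - circ b (rhd a c)) ∧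
  (∀ a b c : A, lhd (circ b c) a - circ b (lhd c a) = lhd (circ c b) a - circ c (lhd b a)) ∧
  (∀ a b c : A, circ (rhd a b) c = circ (rhd a c) b) ∧
  (∀ a b c : A, lhd (circ a b) c = circ (lhd a c) b)

/-- Rota-Baxter operator of weight `lam` on the Novikov algebra `(A, mulA)`. -/
def IsRotaBaxter (mulA : A →ₗ[k] A →ₗ[k] A) (lam : k) (T : A →ₗ[k] A) : Prop :=
  ∀ x y : A, mulA (T x) (T y) = T (mulA (T x) y + mulA x (T y) + lam • mulA x y)

/-- `β : M → A` is balanced. -/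
def IsBalanced (l r : A →ₗ[k] Module.End k M) (β : M →ₗ[k] A) : Prop :=
  ∀ u v : M, l (β u) v = r (β v) u

/-- `β : M → A` is A-invariant of mass `κ`. -/
def IsAInvariant (mulA : A →ₗ[k] A →ₗ[k] A) (l r : A →ₗ[k] Module.End k M)
    (κ : k) (β : M →ₗ[k] A) : Prop :=
  (∀ (x : A) (u : M), κ • mulA x (β u) = κ • β (l x u)) ∧
  (∀ (x : A) (u : M), κ • mulA (β u) x = κ • β (r x u))

/-- `β : M → A` is equivalent of mass `μ`. -/
def IsEquivalentOfMass (mulM : M →ₗ[k] M →ₗ[k] M) (l r : A →ₗ[k] Module.End k M)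
    (μ : k) (β : M →ₗ[k] A) : Prop :=
  (∀ u v w : M, μ • l (β (mulM u v)) w = μ • mulM (l (β u) v) w) ∧
  (∀ u v w : M, μ • r (β (mulM v w)) u = μ • mulM u (r (β w) v))

/-- `β : M → A` is an A-bimodule homomorphism from `(M, l, r)` to `(A, L_A, R_A)`. -/
def IsBimoduleHom (mulA : A →ₗ[k] A →ₗ[k] A) (l r : A →ₗ[k] Module.End k M)
    (β : M →ₗ[k] A) : Prop :=
  (∀ (x : A) (u : M), β (l x u) = mulA x (β u)) ∧
  (∀ (x : A) (u : M), β (r x u) = mulA (β u) x)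

/-- Extended O-operator of weight `lam` with extension `β` of mass `(κ, μ)`. -/
def IsExtendedOOperator (mulA : A →ₗ[k] A →ₗ[k] A) (mulM : M →ₗ[k] M →ₗ[k] M)
    (l r : A →ₗ[k] Module.End k M) (lam κ μ : k) (α β : M →ₗ[k] A) : Prop :=
  IsBalanced l r β ∧ IsAInvariant mulA l r κ β ∧ IsEquivalentOfMass mulM l r μ β ∧
  ∀ u v : M, mulA (α u) (α v) - α (l (α u) v + r (α v) u + lam • mulM u v)
    = κ • mulA (β u) (β v) + μ • β (mulM u v)

end Defs

section DualDefs
variable {k : Type*} [Field k] [CharZero k]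
variable {A : Type*} [AddCommGroup A] [Module k A]
variable {M : Type*} [AddCommGroup M] [Module k M]

/-- The dual representation `φ*` of `φ : A → End M`, with `⟨φ*(a) f, v⟩ = −⟨f, φ(a) v⟩`. -/
noncomputable def dualRep (φ : A →ₗ[k] Module.End k M) :
    A →ₗ[k] Module.End k (Module.Dual k M) :=
  (Module.Dual.transpose (R := k)) ∘ₗ (-φ)


/-- The negative `−φ*` of the dual representation, i.e. `a ↦ (f ↦ f ∘ φ(a))`;
for `φ = R` this is the action `−R*`. -/
noncomputable def negDualRep (φ : A →ₗ[k] Module.End k M) :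
    A →ₗ[k] Module.End k (Module.Dual k M) :=
  (Module.Dual.transpose (R := k)) ∘ₗ φ

/-- The linear map `A ⊗ A → Hom(A*, A)`, `x ⊗ y ↦ (f ↦ f(x) • y)`, sending `r` to `r̂`. -/
noncomputable def hatMap : A ⊗[k] A →ₗ[k] (Module.Dual k A →ₗ[k] A) :=
  TensorProduct.lift
    (LinearMap.mk₂ k (fun x y => LinearMap.smulRight (Module.Dual.eval k A x) y)
      (fun x x' y => by
        ext f
        simp only [LinearMap.smulRight_apply, Module.Dual.eval_apply, LinearMap.add_apply,
          map_add, add_smul])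
      (fun c x y => by
        ext f
        simp only [LinearMap.smulRight_apply, Module.Dual.eval_apply, LinearMap.smul_apply,
          map_smul, smul_assoc])
      (fun x y y' => by
        ext f
        simp only [LinearMap.smulRight_apply, Module.Dual.eval_apply, LinearMap.add_apply,
          smul_add])
      (fun c x y => by
        ext f
        exact smul_comm _ _ _))

/-- `s ∈ A ⊗ A` is invariant: `(L(x) ⊗ id + id ⊗ L⋆(x)) s = 0` for all `x ∈ A`. -/
def IsInvariantTensor (mulA : A →ₗ[k] A →ₗ[k] A) (s : A ⊗[k] A) : Prop :=
  ∀ x : A, TensorProduct.map (mulA x) LinearMap.id s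
      + TensorProduct.map LinearMap.id ((mulA + mulA.flip) x) s = 0

/-- The bilinear operation sending `(r, r')` to `r₁₃ ∘ r'₂₃ = Σ xᵢ ⊗ x'ⱼ ⊗ (yᵢ ∘ y'ⱼ)`. -/
noncomputable def t1323 (m : A →ₗ[k] A →ₗ[k] A) :
    (A ⊗[k] A) ⊗[k] (A ⊗[k] A) →ₗ[k] (A ⊗[k] A) ⊗[k] A :=
  TensorProduct.map LinearMap.id (TensorProduct.lift m) ∘ₗ
    (TensorProduct.tensorTensorTensorComm k A A A A).toLinearMap

/-- The bilinear operation sending `(r, r')` to `r₁₂ m r'₂₃ = Σ xᵢ ⊗ (yᵢ m x'ⱼ) ⊗ y'ⱼ`. -/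
noncomputable def t1223 (m : A →ₗ[k] A →ₗ[k] A) :
    (A ⊗[k] A) ⊗[k] (A ⊗[k] A) →ₗ[k] (A ⊗[k] A) ⊗[k] A :=
  (TensorProduct.assoc k A A A).symm.toLinearMap ∘ₗ
  TensorProduct.map LinearMap.id
    (TensorProduct.map (TensorProduct.lift m) LinearMap.id ∘ₗ
      (TensorProduct.assoc k A A A).symm.toLinearMap) ∘ₗ
  (TensorProduct.assoc k A A (A ⊗[k] A)).toLinearMap

/-- The bilinear operation sending `(r, r')` to `r₁₃ ∘ r'₁₂ = Σ (xᵢ ∘ x'ⱼ) ⊗ y'ⱼ ⊗ yᵢ`. -/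
noncomputable def t1312 (m : A →ₗ[k] A →ₗ[k] A) :
    (A ⊗[k] A) ⊗[k] (A ⊗[k] A) →ₗ[k] (A ⊗[k] A) ⊗[k] A :=
  (TensorProduct.assoc k A A A).symm.toLinearMap ∘ₗ
  TensorProduct.map (TensorProduct.lift m) (TensorProduct.comm k A A).toLinearMap ∘ₗ
  (TensorProduct.tensorTensorTensorComm k A A A A).toLinearMap

/-- `r₁₃∘r₂₃ + r₁₂⋆r₂₃ + r₁₃∘r₁₂` as an element of `A ⊗ A ⊗ A` (grouping `(A ⊗ A) ⊗ A`). -/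
noncomputable def nybeLHS (mulA : A →ₗ[k] A →ₗ[k] A) (r : A ⊗[k] A) : (A ⊗[k] A) ⊗[k] A :=
  t1323 mulA (r ⊗ₜ[k] r) + t1223 (mulA + mulA.flip) (r ⊗ₜ[k] r) + t1312 mulA (r ⊗ₜ[k] r)

/-- `r` is a solution of the Novikov Yang–Baxter equation in `A`. -/
def IsNYBESolution (mulA : A →ₗ[k] A →ₗ[k] A) (r : A ⊗[k] A) : Prop :=
  nybeLHS mulA r = 0

/-- `r` is a solution of the extended Novikov Yang–Baxter equation of mass `ε` in `A`. -/
def IsENYBESolution (mulA : A →ₗ[k] A →ₗ[k] A) (ε : k) (r : A ⊗[k] A) : Prop :=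
  nybeLHS mulA r
    = ε • t1323 mulA ((r + TensorProduct.comm k A A r) ⊗ₜ[k] (r + TensorProduct.comm k A A r))

end DualDefs

section Pairing

variable {k : Type*} [Field k] {A : Type*} [AddCommGroup A] [Module k A]

theorem TensorProduct.eq_zero_of_forall_dualDistrib {M N : Type*} [AddCommGroup M] [Module k M]
    [AddCommGroup N] [Module k N] [FiniteDimensional k M] [FiniteDimensional k N]
    {t : M ⊗[k] N}
    (h : ∀ (f : Module.Dual k M) (g : Module.Dual k N), dualDistrib k M N (f ⊗ₜ g) t = 0) :
    t = 0 := by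
  rw [← Module.forall_dual_apply_eq_zero_iff k]
  intro φ
  obtain ⟨u, rfl⟩ := (dualDistribEquiv k M N).surjective φ
  change dualDistrib k M N u t = 0
  induction u with
  | zero => simp
  | tmul f g => exact h f g
  | add x y hx hy => simp [hx, hy]

theorem TensorProduct.eq_zero_of_forall_dualDistrib₃ [FiniteDimensional k A]
    {t : (A ⊗[k] A) ⊗[k] A}
    (h : ∀ a b c : Module.Dual k A,
      dualDistrib k (A ⊗[k] A) A (dualDistrib k A A (a ⊗ₜ b) ⊗ₜ c) t = 0) : t = 0 := by
  refine eq_zero_of_forall_dualDistrib fun f c => ?_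
  obtain ⟨u, rfl⟩ := (dualDistribEquiv k A A).surjective f
  change dualDistrib k (A ⊗[k] A) A (dualDistrib k A A u ⊗ₜ c) t = 0
  induction u with
  | zero => simp
  | tmul a b => exact h a b c
  | add x y hx hy => simp [add_tmul, hx, hy]

theorem TensorProduct.dualDistrib_map {M N : Type*} [AddCommGroup M] [Module k M]
    [AddCommGroup N] [Module k N] (f : Module.Dual k M) (g : Module.Dual k N)
    (u : M →ₗ[k] M) (v : N →ₗ[k] N) (s : M ⊗[k] N) :
    dualDistrib k M N (f ⊗ₜ g) (map u v s) = dualDistrib k M N ((f ∘ₗ u) ⊗ₜ (g ∘ₗ v)) s := by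
  induction s with
  | zero => simp
  | tmul x y => simp
  | add x y hx hy => simp [hx, hy]

theorem dualDistrib_apply_eq_hatMap (s : A ⊗[k] A) (a b : Module.Dual k A) :
    dualDistrib k A A (a ⊗ₜ b) s = b (hatMap s a) := by
  induction s with
  | zero => simp
  | tmul x y => simp [hatMap]
  | add x y hx hy => simp [hx, hy]

theorem hatMap_comm_apply (s : A ⊗[k] A) (a b : Module.Dual k A) :
    a (hatMap (TensorProduct.comm k A A s) b) = b (hatMap s a) := by
  induction s with
  | zero => simp
  | tmul x y => simp [hatMap, mul_comm]
  | add x y hx hy => simp [hx, hy]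

theorem dualDistrib_t1323 (m : A →ₗ[k] A →ₗ[k] A) (r s : A ⊗[k] A) (a b c : Module.Dual k A) :
    dualDistrib k (A ⊗[k] A) A (dualDistrib k A A (a ⊗ₜ b) ⊗ₜ c) (t1323 m (r ⊗ₜ s))
      = c (m (hatMap r a) (hatMap s b)) := by
  induction r with
  | zero => simp
  | add x y hx hy => simp [add_tmul, hx, hy]
  | tmul x y =>
    induction s with
    | zero => simp
    | add x y hx hy => simp_all [tmul_add]
    | tmul z w => simp [t1323, hatMap]; ring

theorem dualDistrib_t1223 (m : A →ₗ[k] A →ₗ[k] A) (r s : A ⊗[k] A) (a b c : Module.Dual k A) :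
    dualDistrib k (A ⊗[k] A) A (dualDistrib k A A (a ⊗ₜ b) ⊗ₜ c) (t1223 m (r ⊗ₜ s))
      = b (m (hatMap r a) (hatMap (TensorProduct.comm k A A s) c)) := by
  induction r with
  | zero => simp
  | add x y hx hy => simp [add_tmul, hx, hy]
  | tmul x y =>
    induction s with
    | zero => simp
    | add x y hx hy => simp_all [tmul_add]
    | tmul z w => simp [t1223, hatMap]; ring

theorem dualDistrib_t1312 (m : A →ₗ[k] A →ₗ[k] A) (r s : A ⊗[k] A) (a b c : Module.Dual k A) :
    dualDistrib k (A ⊗[k] A) A (dualDistrib k A A (a ⊗ₜ b) ⊗ₜ c) (t1312 m (r ⊗ₜ s))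
      = a (m (hatMap (TensorProduct.comm k A A r) c) (hatMap (TensorProduct.comm k A A s) b)) := by
  induction r with
  | zero => simp
  | add x y hx hy => simp [add_tmul, hx, hy]
  | tmul x y =>
    induction s with
    | zero => simp
    | add x y hx hy => simp_all [tmul_add]
    | tmul z w => simp [t1312, hatMap]; ring

theorem dualRep_apply_apply [CharZero k] (φ : A →ₗ[k] Module.End k A) (x v : A)
    (f : Module.Dual k A) : dualRep φ x f v = -f (φ x v) := by
  simp [dualRep, Module.Dual.transpose_apply]

theorem eq_of_forall_dual_apply_eq {x y : A} (h : ∀ c : Module.Dual k A, c x = c y) : x = y := by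
  rw [← sub_eq_zero, ← Module.forall_dual_apply_eq_zero_iff k]
  simp [h]

theorem isNYBESolution_iff_hatMap [CharZero k] [FiniteDimensional k A]
    (mulA : A →ₗ[k] A →ₗ[k] A) (r : A ⊗[k] A) :
    IsNYBESolution mulA r ↔ ∀ a b : Module.Dual k A,
      hatMap r (dualRep (mulA + mulA.flip) (hatMap r a) b
          + dualRep mulA.flip (hatMap (TensorProduct.comm k A A r) b) a)
        = mulA (hatMap r a) (hatMap r b) := by
  have pair (a b c : Module.Dual k A) :
      dualDistrib k (A ⊗[k] A) A (dualDistrib k A A (a ⊗ₜ b) ⊗ₜ c) (nybeLHS mulA r)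
        = c (mulA (hatMap r a) (hatMap r b)) - c (hatMap r
          (dualRep (mulA + mulA.flip) (hatMap r a) b
            + dualRep mulA.flip (hatMap (TensorProduct.comm k A A r) b) a)) := by
    rw [← hatMap_comm_apply r _ c]
    simp only [nybeLHS, map_add, dualDistrib_t1323, dualDistrib_t1223, dualDistrib_t1312,
      LinearMap.add_apply, dualRep_apply_apply, LinearMap.flip_apply]
    ring
  constructor
  · intro h a b
    refine eq_of_forall_dual_apply_eq (k := k) fun c => ?_
    have := pair a b c
    rw [show nybeLHS mulA r = 0 from h, map_zero] at this
    exact (sub_eq_zero.mp this.symm).symm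
  · intro h
    refine TensorProduct.eq_zero_of_forall_dualDistrib₃ fun a b c => ?_
    rw [pair, h, sub_self]

/-- Invariance of `s` in terms of `ŝ`. -/
theorem IsInvariantTensor.apply_mul_hatMap [CharZero k] {mulA : A →ₗ[k] A →ₗ[k] A}
    {s : A ⊗[k] A} (h : IsInvariantTensor mulA s) (x : A) (a b : Module.Dual k A) :
    a (mulA x (hatMap (TensorProduct.comm k A A s) b))
      + b ((mulA + mulA.flip) x (hatMap s a)) = 0 := by
  have := congrArg (dualDistrib k A A (a ⊗ₜ b)) (h x)
  rw [map_add, map_zero, TensorProduct.dualDistrib_map, TensorProduct.dualDistrib_map,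
    dualDistrib_apply_eq_hatMap, dualDistrib_apply_eq_hatMap, LinearMap.comp_id, LinearMap.comp_id,
    ← hatMap_comm_apply s (a ∘ₗ mulA x)] at this
  exact this

end Pairing

/-- If the symmetric part of `r` is invariant, the four conditions
(NYBE solution; O-operator form for `r̂` and `−r̂ᵗ`; extended O-operator of mass `(−1,0)`;
multiplicativity of `α ± β`) are equivalent. -/
theorem nybe_equivalent_characterizations
    {k : Type*} [Field k] [CharZero k]
    {A : Type*} [AddCommGroup A] [Module k A] [FiniteDimensional k A]
    (mulA : A →ₗ[k] A →ₗ[k] A) (hA : IsNovikov mulA) (r : A ⊗[k] A)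
    (hinv : IsInvariantTensor mulA ((2 : k)⁻¹ • (r + TensorProduct.comm k A A r)))
    (α β : Module.Dual k A →ₗ[k] A)
    (hα : α = (2 : k)⁻¹ • (hatMap r - hatMap (TensorProduct.comm k A A r)))
    (hβ : β = (2 : k)⁻¹ • (hatMap r + hatMap (TensorProduct.comm k A A r))) :
    (IsNYBESolution mulA r ↔
      ((∀ a b : Module.Dual k A,
          mulA (hatMap r a) (hatMap r b)
            = hatMap r (dualRep (mulA + mulA.flip) (hatMap r a) b
                - dualRep mulA.flip (hatMap r b) a
                - (2 : k) • dualRep (mulA + mulA.flip) (β a) b)) ∧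
       (∀ a b : Module.Dual k A,
          mulA ((-(hatMap (TensorProduct.comm k A A r))) a)
              ((-(hatMap (TensorProduct.comm k A A r))) b)
            = (-(hatMap (TensorProduct.comm k A A r)))
                (dualRep (mulA + mulA.flip) ((-(hatMap (TensorProduct.comm k A A r))) a) b
                  - dualRep mulA.flip ((-(hatMap (TensorProduct.comm k A A r))) b) a
                  + (2 : k) • dualRep (mulA + mulA.flip) (β a) b)))) ∧
    (IsNYBESolution mulA r ↔
      (∀ a b : Module.Dual k A,
        mulA (α a) (α b)
            - α (dualRep (mulA + mulA.flip) (α a) b - dualRep mulA.flip (α b) a)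
          = - mulA (β a) (β b))) ∧
    (IsNYBESolution mulA r ↔
      ((∀ a b : Module.Dual k A,
          (α + β) (dualRep (mulA + mulA.flip) (hatMap r a) b
              + dualRep mulA.flip (hatMap (TensorProduct.comm k A A r) b) a)
            = mulA ((α + β) a) ((α + β) b)) ∧
       (∀ a b : Module.Dual k A,
          (α - β) (dualRep (mulA + mulA.flip) (hatMap r a) b
              + dualRep mulA.flip (hatMap (TensorProduct.comm k A A r) b) a)
            = mulA ((α - β) a) ((α - β) b)))) := by
  have hPβ : hatMap r = α + β := by
    rw [hα, hβ]; module
  have hQβ : hatMap (TensorProduct.comm k A A r) = β - α := by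
    rw [hα, hβ]; module
  have hs : hatMap ((2 : k)⁻¹ • (r + TensorProduct.comm k A A r)) = β := by
    rw [hβ, map_smul, map_add]
  have hs' : hatMap (TensorProduct.comm k A A
      ((2 : k)⁻¹ • (r + TensorProduct.comm k A A r))) = β := by
    rw [hβ, map_smul, map_add, map_smul, map_add, TensorProduct.comm_comm, add_comm]
  have βsymm (a b : Module.Dual k A) : a (β b) = b (β a) := by
    have := hatMap_comm_apply ((2 : k)⁻¹ • (r + TensorProduct.comm k A A r)) a b
    rwa [hs, hs'] at this
  have inv (x : A) (a b : Module.Dual k A) :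
      a (mulA x (β b)) + (b (mulA x (β a)) + b (mulA (β a) x)) = 0 := by
    have := hinv.apply_mul_hatMap x a b
    rwa [hs, hs', LinearMap.add_apply, LinearMap.add_apply, map_add,
      LinearMap.flip_apply] at this
  have balanced (a b : Module.Dual k A) :
      dualRep (mulA + mulA.flip) (β a) b = -dualRep mulA.flip (β b) a := by
    ext x
    simp only [LinearMap.neg_apply, dualRep_apply_apply, LinearMap.add_apply,
      LinearMap.flip_apply, map_add]
    linear_combination -inv x a b
  have β_left (x : A) (b : Module.Dual k A) :
      β (dualRep (mulA + mulA.flip) x b) = mulA x (β b) := by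
    refine eq_of_forall_dual_apply_eq (k := k) fun c => ?_
    rw [βsymm, dualRep_apply_apply]
    simp only [LinearMap.add_apply, LinearMap.flip_apply, map_add]
    linear_combination -inv x c b
  have β_right (x : A) (a : Module.Dual k A) :
      β (dualRep mulA.flip x a) = -mulA (β a) x := by
    refine eq_of_forall_dual_apply_eq (k := k) fun c => ?_
    rw [βsymm, dualRep_apply_apply]
    simp only [LinearMap.flip_apply, map_neg]
    linear_combination inv x a c - inv x c a
  have star_eq (a b : Module.Dual k A) :
      dualRep (mulA + mulA.flip) ((α + β) a) b + dualRep mulA.flip ((β - α) b) a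
        = dualRep (mulA + mulA.flip) (α a) b - dualRep mulA.flip (α b) a := by
    simp only [LinearMap.add_apply (f := α), LinearMap.sub_apply (f := β), map_add, map_sub,
      LinearMap.add_apply, LinearMap.sub_apply, balanced]
    abel
  have β_star (a b : Module.Dual k A) :
      β (dualRep (mulA + mulA.flip) (α a) b - dualRep mulA.flip (α b) a)
        = mulA (α a) (β b) + mulA (β a) (α b) := by
    rw [map_sub, β_left, β_right, sub_neg_eq_add]
  have arg_hat (a b : Module.Dual k A) :
      dualRep (mulA + mulA.flip) ((α + β) a) b - dualRep mulA.flip ((α + β) b) a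
          - (2 : k) • dualRep (mulA + mulA.flip) (β a) b
        = dualRep (mulA + mulA.flip) (α a) b - dualRep mulA.flip (α b) a := by
    rw [balanced]
    rw [LinearMap.add_apply α β a, LinearMap.add_apply α β b, map_add, map_add,
      LinearMap.add_apply _ _ b, LinearMap.add_apply _ _ a, balanced]
    module
  have arg_neg_hat (a b : Module.Dual k A) :
      dualRep (mulA + mulA.flip) ((α - β) a) b - dualRep mulA.flip ((α - β) b) a
          + (2 : k) • dualRep (mulA + mulA.flip) (β a) b
        = dualRep (mulA + mulA.flip) (α a) b - dualRep mulA.flip (α b) a := by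
    rw [LinearMap.sub_apply α β a, LinearMap.sub_apply α β b, map_sub, map_sub,
      LinearMap.sub_apply _ _ b, LinearMap.sub_apply _ _ a, balanced]
    module
  have plus_iff (a b : Module.Dual k A) :
      (α + β) (dualRep (mulA + mulA.flip) (α a) b - dualRep mulA.flip (α b) a)
          = mulA ((α + β) a) ((α + β) b) ↔
        mulA (α a) (α b) - α (dualRep (mulA + mulA.flip) (α a) b - dualRep mulA.flip (α b) a)
          = -mulA (β a) (β b) := by
    rw [LinearMap.add_apply α β (_ - _), β_star]
    simp only [LinearMap.add_apply α β, map_add mulA, LinearMap.add_apply (mulA _), map_add]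
    constructor <;> intro h <;> linear_combination (norm := module) -h
  have minus_iff (a b : Module.Dual k A) :
      (α - β) (dualRep (mulA + mulA.flip) (α a) b - dualRep mulA.flip (α b) a)
          = mulA ((α - β) a) ((α - β) b) ↔
        mulA (α a) (α b) - α (dualRep (mulA + mulA.flip) (α a) b - dualRep mulA.flip (α b) a)
          = -mulA (β a) (β b) := by
    rw [LinearMap.sub_apply α β (_ - _), β_star]
    simp only [LinearMap.sub_apply α β, map_sub mulA, LinearMap.sub_apply (mulA _), map_sub]
    constructor <;> intro h <;> linear_combination (norm := module) -h
  have hneg : -(β - α) = α - β := neg_sub β α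
  rw [isNYBESolution_iff_hatMap]
  simp only [hPβ, hQβ, hneg, star_eq, arg_hat, arg_neg_hat, plus_iff, minus_iff,
    eq_comm (a := mulA ((α + β) _) _), eq_comm (a := mulA ((α - β) _) _), and_self]
end

section
/- Let (A, ∘, B) be a finite-dimensional quadratic Novikov algebra with induced isomorphism φ : A → A*, and β : A → A a linear map which is self-adjoint with respect to B. Then β is a balanced A-bimodule homomorphism from (A, L_A, R_A) to (A, L_A, R_A) (i.e. β(x)∘y = x∘β(y), β(x∘y) = x∘β(y) and β(y∘x) = β(y)∘x for all x, y ∈ A) if and only if βφ⁻¹ : A* → A is a balanced A-bimodule homomorphism from (A*, L_{A,⋆}*, −R_A*) to (A, L_A, R_A), i.e. L_{A,⋆}*(βφ⁻¹(a*))b* = −R_A*(βφ⁻¹(b*))a*, βφ⁻¹(L_{A,⋆}*(x)a*) = x∘βφ⁻¹(a*) and βφ⁻¹(−R_A*(x)a*) = βφ⁻¹(a*)∘x for all a*, b* ∈ A*, x ∈ A. -/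
open TensorProduct


section InducedIsomorphism

variable {k : Type*} [Field k] {A : Type*} [AddCommGroup A] [Module k A]
  {mulA : A →ₗ[k] A →ₗ[k] A} {B : A →ₗ[k] A →ₗ[k] k} {φ : A ≃ₗ[k] Module.Dual k A}

/-- The isomorphism induced by a quadratic form intertwines `L` and `L⋆*`. -/
theorem dualRep_star_induced [CharZero k]
    (hBinv : ∀ a b c : A, B (mulA a b) c = - B b (mulA a c + mulA c a))
    (hφ : ∀ a b : A, φ a b = B a b) (x a : A) :
    dualRep (mulA + mulA.flip) x (φ a) = φ (mulA x a) := by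
  ext c
  simp [dualRep, Module.Dual.transpose_apply, hφ, hBinv]

/-- The isomorphism induced by a quadratic form intertwines `R` and `-R*`. -/
theorem negDualRep_flip_induced [CharZero k] (hsym : ∀ a b : A, B a b = B b a)
    (hBinv : ∀ a b c : A, B (mulA a b) c = - B b (mulA a c + mulA c a))
    (hφ : ∀ a b : A, φ a b = B a b) (x a : A) :
    negDualRep mulA.flip x (φ a) = φ (mulA a x) := by
  ext c
  have h : B a (mulA c x) = B (mulA a x) c := by
    rw [hsym a, hBinv, hBinv, add_comm]
  simpa [negDualRep, Module.Dual.transpose_apply, hφ] using h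

end InducedIsomorphism

/-- On a quadratic Novikov algebra, a self-adjoint `β` is a balanced
`A`-bimodule homomorphism from `(A, L, R)` to itself iff `β ∘ φ⁻¹` is a balanced
`A`-bimodule homomorphism from `(A*, L⋆*, −R*)` to `(A, L, R)`. -/
theorem selfAdjoint_balancedHom_iff_dual_balancedHom
    {k : Type*} [Field k] [CharZero k]
    {A : Type*} [AddCommGroup A] [Module k A] [FiniteDimensional k A]
    (mulA : A →ₗ[k] A →ₗ[k] A) (hA : IsNovikov mulA)
    (B : A →ₗ[k] A →ₗ[k] k)
    (hsym : ∀ a b : A, B a b = B b a)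
    (hnd : ∀ a : A, (∀ b : A, B a b = 0) → a = 0)
    (hBinv : ∀ a b c : A, B (mulA a b) c = - B b (mulA a c + mulA c a))
    (φ : A ≃ₗ[k] Module.Dual k A) (hφ : ∀ a b : A, φ a b = B a b)
    (β : A →ₗ[k] A) (hsa : ∀ a b : A, B (β a) b = B a (β b)) :
    ((∀ x y : A, mulA (β x) y = mulA x (β y)) ∧
     (∀ x y : A, β (mulA x y) = mulA x (β y)) ∧
     (∀ x y : A, β (mulA y x) = mulA (β y) x)) ↔
    (IsBalanced (dualRep (mulA + mulA.flip)) (negDualRep mulA.flip)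
        (β ∘ₗ φ.symm.toLinearMap) ∧
     IsBimoduleHom mulA (dualRep (mulA + mulA.flip)) (negDualRep mulA.flip)
        (β ∘ₗ φ.symm.toLinearMap)) := by
  have hl := dualRep_star_induced hBinv hφ
  have hr := negDualRep_flip_induced hsym hBinv hφ
  have hbal : IsBalanced (dualRep (mulA + mulA.flip)) (negDualRep mulA.flip)
      (β ∘ₗ φ.symm.toLinearMap) ↔ ∀ x y : A, mulA (β x) y = mulA x (β y) := by
    simp [IsBalanced, φ.surjective.forall, hl, hr]
  have hhom : IsBimoduleHom mulA (dualRep (mulA + mulA.flip)) (negDualRep mulA.flip)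
      (β ∘ₗ φ.symm.toLinearMap) ↔ (∀ x y : A, β (mulA x y) = mulA x (β y)) ∧
        ∀ x y : A, β (mulA y x) = mulA (β y) x := by
    simp [IsBimoduleHom, φ.surjective.forall, hl, hr]
  rw [hbal, hhom]
end

section
/- Let (A, ∘, B) be a finite-dimensional quadratic Novikov algebra with induced isomorphism φ : A → A*, T : A → A a linear map, κ ∈ k, and β : A → A a balanced A-bimodule homomorphism from (A, L_A, R_A) to itself (β(x)∘y = x∘β(y), β(x∘y) = x∘β(y), β(y∘x) = β(y)∘x) which is self-adjoint with respect to B. Then: (i) T satisfies T(x)∘T(y) − T(T(x)∘y + x∘T(y)) = κ β(x)∘β(y) for all x, y ∈ A if and only if P_T := Tφ⁻¹ : A* → A satisfies P_T(a*)∘P_T(b*) − P_T(L_{A,⋆}*(P_T(a*))b* − R_A*(P_T(b*))a*) = κ P_β(a*)∘P_β(b*) for all a*, b* ∈ A*, where P_β := βφ⁻¹. (ii) If in addition T is skew-adjoint with respect to B, then for either sign the element of A⊗A corresponding to the linear map Tφ⁻¹ ± βφ⁻¹ : A* → A is a solution of the extended Novikov Yang–Baxter equation of mass (κ+1)/4 in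 A if and only if T satisfies T(x)∘T(y) − T(T(x)∘y + x∘T(y)) = κ β(x)∘β(y) for all x, y ∈ A. -/
open TensorProduct


section Contraction
variable {k : Type*} [Field k]
variable {A : Type*} [AddCommGroup A] [Module k A]

/-- The contraction `(x ⊗ y) ⊗ z ↦ f(x) g(y) z` of the first two tensor factors. -/
noncomputable def contractFirstTwo (f g : Module.Dual k A) : (A ⊗[k] A) ⊗[k] A →ₗ[k] A :=
  (TensorProduct.lid k A).toLinearMap ∘ₗ
    LinearMap.rTensor A ((TensorProduct.lid k k).toLinearMap ∘ₗ TensorProduct.map f g)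

@[simp]
lemma contractFirstTwo_tmul (f g : Module.Dual k A) (x y z : A) :
    contractFirstTwo f g ((x ⊗ₜ[k] y) ⊗ₜ[k] z) = (f x * g y) • z := by
  simp [contractFirstTwo]

lemma eq_of_contractFirstTwo_eq {s t : (A ⊗[k] A) ⊗[k] A}
    (h : ∀ f g : Module.Dual k A, contractFirstTwo f g s = contractFirstTwo f g t) : s = t := by
  let b := Module.Basis.ofVectorSpace k A
  apply ((b.tensorProduct b).tensorProduct b).ext_elem
  rintro ⟨⟨i, j⟩, l⟩
  have key : ((b.tensorProduct b).tensorProduct b).coord ((i, j), l)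
      = b.coord l ∘ₗ contractFirstTwo (b.coord i) (b.coord j) := by
    ext x y z
    simp [Module.Basis.tensorProduct_repr_tmul_apply]
    ring
  have := congrArg (b.coord l) (h (b.coord i) (b.coord j))
  rw [← LinearMap.comp_apply, ← LinearMap.comp_apply, ← key] at this
  exact this

end Contraction

lemma dualRep_apply {k : Type*} [Field k] {A M : Type*} [AddCommGroup A] [Module k A]
    [AddCommGroup M] [Module k M] (φ : A →ₗ[k] Module.End k M) (a : A) (f : Module.Dual k M) :
    dualRep φ a f = -(f ∘ₗ φ a) :=
  LinearMap.ext fun v => map_neg f (φ a v)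

section HatMap
variable {k : Type*} [Field k]
variable {A : Type*} [AddCommGroup A] [Module k A]

@[simp]
lemma hatMap_tmul (x y : A) (f : Module.Dual k A) : hatMap (x ⊗ₜ[k] y) f = f x • y := by
  simp [hatMap]

lemma apply_hatMap_comm (r : A ⊗[k] A) (f g : Module.Dual k A) :
    g (hatMap (TensorProduct.comm k A A r) f) = f (hatMap r g) := by
  induction r with
  | zero => simp
  | add r s hr hs => simp [hr, hs]
  | tmul x y => simp [mul_comm]

lemma contractFirstTwo_t1323 (m : A →ₗ[k] A →ₗ[k] A) (r s : A ⊗[k] A) (f g : Module.Dual k A) :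
    contractFirstTwo f g (t1323 m (r ⊗ₜ[k] s)) = m (hatMap r f) (hatMap s g) := by
  induction r with
  | zero => simp
  | add r r' hr hr' => simp [TensorProduct.add_tmul, hr, hr']
  | tmul x y =>
    induction s with
    | zero => simp
    | add s s' hs hs' => simp only [TensorProduct.tmul_add, map_add, hs, hs', LinearMap.add_apply]
    | tmul z w =>
      simp only [t1323, LinearMap.comp_apply, LinearEquiv.coe_coe,
        TensorProduct.tensorTensorTensorComm_tmul, TensorProduct.map_tmul, LinearMap.id_apply,
        TensorProduct.lift.tmul, contractFirstTwo_tmul, hatMap_tmul, map_smul,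
        LinearMap.smul_apply, smul_smul, mul_comm (f x)]

lemma contractFirstTwo_t1223 (m : A →ₗ[k] A →ₗ[k] A) (r s : A ⊗[k] A) (f g : Module.Dual k A) :
    contractFirstTwo f g (t1223 m (r ⊗ₜ[k] s)) = hatMap s (g ∘ₗ m (hatMap r f)) := by
  induction r with
  | zero => simp
  | add r r' hr hr' => simp [TensorProduct.add_tmul, hr, hr', LinearMap.comp_add]
  | tmul x y =>
    induction s with
    | zero => simp
    | add s s' hs hs' => simp only [TensorProduct.tmul_add, map_add, hs, hs', LinearMap.add_apply]
    | tmul z w => simp [t1223]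

lemma contractFirstTwo_t1312 (m : A →ₗ[k] A →ₗ[k] A) (r s : A ⊗[k] A) (f g : Module.Dual k A) :
    contractFirstTwo f g (t1312 m (r ⊗ₜ[k] s))
      = hatMap r (f ∘ₗ m.flip (hatMap (TensorProduct.comm k A A s) g)) := by
  induction r with
  | zero => simp
  | add r r' hr hr' => simp only [TensorProduct.add_tmul, map_add, hr, hr', LinearMap.add_apply]
  | tmul x y =>
    induction s with
    | zero => simp
    | add s s' hs hs' =>
      simp only [TensorProduct.tmul_add, map_add, hs, hs', LinearMap.comp_add, LinearMap.add_apply]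
    | tmul z w => simp [t1312, mul_comm]

lemma isENYBESolution_iff_hatMap (m : A →ₗ[k] A →ₗ[k] A) (c : k) (r : A ⊗[k] A) :
    IsENYBESolution m c r ↔ ∀ f g : Module.Dual k A,
      m (hatMap r f) (hatMap r g) + hatMap r (g ∘ₗ (m + m.flip) (hatMap r f))
          + hatMap r (f ∘ₗ m.flip (hatMap (TensorProduct.comm k A A r) g))
        = c • m ((hatMap r + hatMap (TensorProduct.comm k A A r)) f)
            ((hatMap r + hatMap (TensorProduct.comm k A A r)) g) := by
  have hL : ∀ f g : Module.Dual k A, contractFirstTwo f g (nybeLHS m r)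
      = m (hatMap r f) (hatMap r g) + hatMap r (g ∘ₗ (m + m.flip) (hatMap r f))
          + hatMap r (f ∘ₗ m.flip (hatMap (TensorProduct.comm k A A r) g)) := fun f g => by
    rw [nybeLHS, map_add, map_add, contractFirstTwo_t1323, contractFirstTwo_t1223,
      contractFirstTwo_t1312]
  have hR : ∀ f g : Module.Dual k A,
      contractFirstTwo f g (c • t1323 m ((r + TensorProduct.comm k A A r) ⊗ₜ[k]
          (r + TensorProduct.comm k A A r)))
        = c • m ((hatMap r + hatMap (TensorProduct.comm k A A r)) f)
            ((hatMap r + hatMap (TensorProduct.comm k A A r)) g) := fun f g => by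
    rw [map_smul, contractFirstTwo_t1323, map_add]
  refine ⟨fun h f g => ?_, fun h => eq_of_contractFirstTwo_eq fun f g => ?_⟩
  · rw [← hL, ← hR]
    exact congrArg _ h
  · rw [hL, hR]
    exact h f g

end HatMap

/-- On a quadratic Novikov algebra with `β` a self-adjoint balanced
`A`-bimodule homomorphism: (i) `T` is an extended O-operator of weight `0` with extension
`β` of mass `(κ, 0)` iff `P_T = T∘φ⁻¹` is one with extension `P_β = β∘φ⁻¹`; (ii) if `T` is
moreover skew-adjoint, the tensor corresponding to `T∘φ⁻¹ ± β∘φ⁻¹` satisfies the ENYBE of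
mass `(κ+1)/4` iff `T` is such an extended O-operator. -/
theorem quadratic_extendedOOperator_transfer_and_enybe
    {k : Type*} [Field k] [CharZero k]
    {A : Type*} [AddCommGroup A] [Module k A] [FiniteDimensional k A]
    (mulA : A →ₗ[k] A →ₗ[k] A) (hA : IsNovikov mulA)
    (B : A →ₗ[k] A →ₗ[k] k)
    (hsym : ∀ a b : A, B a b = B b a)
    (hnd : ∀ a : A, (∀ b : A, B a b = 0) → a = 0)
    (hBinv : ∀ a b c : A, B (mulA a b) c = - B b (mulA a c + mulA c a))
    (φ : A ≃ₗ[k] Module.Dual k A) (hφ : ∀ a b : A, φ a b = B a b)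
    (T β : A →ₗ[k] A) (κ : k)
    (hβ1 : ∀ x y : A, mulA (β x) y = mulA x (β y))
    (hβ2 : ∀ x y : A, β (mulA x y) = mulA x (β y))
    (hβ3 : ∀ x y : A, β (mulA y x) = mulA (β y) x)
    (hsa : ∀ a b : A, B (β a) b = B a (β b)) :
    ((∀ x y : A,
        mulA (T x) (T y) - T (mulA (T x) y + mulA x (T y)) = κ • mulA (β x) (β y)) ↔
      (∀ a b : Module.Dual k A,
        mulA ((T ∘ₗ φ.symm.toLinearMap) a) ((T ∘ₗ φ.symm.toLinearMap) b)
            - (T ∘ₗ φ.symm.toLinearMap)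
                (dualRep (mulA + mulA.flip) ((T ∘ₗ φ.symm.toLinearMap) a) b
                  - dualRep mulA.flip ((T ∘ₗ φ.symm.toLinearMap) b) a)
          = κ • mulA ((β ∘ₗ φ.symm.toLinearMap) a) ((β ∘ₗ φ.symm.toLinearMap) b))) ∧
    ((∀ a b : A, B (T a) b = - B a (T b)) →
      ∀ ε : k, (ε = 1 ∨ ε = -1) →
      ∀ u : A ⊗[k] A,
        hatMap u = (T ∘ₗ φ.symm.toLinearMap) + ε • (β ∘ₗ φ.symm.toLinearMap) →
        (IsENYBESolution mulA ((κ + 1) / 4) u ↔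
          ∀ x y : A,
            mulA (T x) (T y) - T (mulA (T x) y + mulA x (T y))
              = κ • mulA (β x) (β y))) := by
  have hL : ∀ a b : A, φ b ∘ₗ (mulA + mulA.flip) a = -φ (mulA a b) := fun a b => by
    ext c
    simp [hφ, hBinv]
  have hR : ∀ a b : A, φ a ∘ₗ mulA.flip b = φ (mulA a b) := fun a b => by
    ext c
    simp only [LinearMap.comp_apply, LinearMap.flip_apply, hφ]
    rw [hsym, hBinv, hBinv, add_comm]
  refine ⟨?_, fun hT ε hε u hu => ?_⟩
  · have hdL : ∀ a b : A, dualRep (mulA + mulA.flip) a (φ b) = φ (mulA a b) := fun a b => by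
      rw [← neg_neg (φ (mulA a b)), ← hL, dualRep_apply]
    have hdR : ∀ a b : A, dualRep mulA.flip b (φ a) = -φ (mulA a b) := fun a b => by
      rw [← hR, dualRep_apply]
    rw [φ.surjective.forall]
    refine forall_congr' fun x => ?_
    rw [φ.surjective.forall]
    refine forall_congr' fun y => ?_
    simp only [LinearMap.comp_apply, LinearEquiv.coe_coe, LinearEquiv.symm_apply_apply, hdL, hdR,
      sub_neg_eq_add, map_add]
  · have hε2 : ε * ε = 1 := by rcases hε with rfl | rfl <;> norm_num
    have hu1 : ∀ x : A, hatMap u (φ x) = T x + ε • β x := fun x => by simp [hu]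
    have hu2 : ∀ x : A, hatMap (TensorProduct.comm k A A u) (φ x) = -T x + ε • β x := fun x => by
      refine φ.injective (LinearMap.ext fun y => ?_)
      rw [hφ, hsym, ← hφ, apply_hatMap_comm, hu1, hφ, hφ]
      simp only [map_add, map_smul, map_neg, LinearMap.add_apply, LinearMap.smul_apply,
        LinearMap.neg_apply, hT, hsa, neg_neg]
    rw [isENYBESolution_iff_hatMap, φ.surjective.forall]
    refine forall_congr' fun x => ?_
    rw [φ.surjective.forall]
    refine forall_congr' fun y => ?_
    have hlhs : mulA (T x + ε • β x) (T y + ε • β y)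
          - (T (mulA (T x + ε • β x) y) + ε • β (mulA (T x + ε • β x) y))
          + (T (mulA x (-T y + ε • β y)) + ε • β (mulA x (-T y + ε • β y)))
        = mulA (T x) (T y) - T (mulA (T x) y + mulA x (T y)) + mulA (β x) (β y) := by
      have hββ : mulA (β x) (β y) = (ε * ε) • mulA (β x) (β y) := by rw [hε2, one_smul]
      rw [hββ]
      simp only [map_add, map_smul, map_neg, LinearMap.add_apply, LinearMap.smul_apply, hβ1, hβ2]
      rw [← hβ2 x (T y), hβ3]
      simp only [hβ1]
      module
    have hrhs : ((κ + 1) / 4) • mulA (T x + ε • β x + (-T x + ε • β x))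
          (T y + ε • β y + (-T y + ε • β y))
        = κ • mulA (β x) (β y) + mulA (β x) (β y) := by
      have h2 : ∀ z : A, T z + ε • β z + (-T z + ε • β z) = (2 * ε) • β z := fun z => by module
      rw [h2, h2, map_smul, map_smul, LinearMap.smul_apply, smul_smul, smul_smul,
        show (κ + 1) / 4 * (2 * ε) * (2 * ε) = (κ + 1) * (ε * ε) by ring, hε2]
      module
    simp only [LinearMap.add_apply (hatMap u), hu1, hu2, hL, hR, map_neg, ← sub_eq_add_neg]
    rw [hlhs, hrhs, add_left_inj]
end
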